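/- Let f be a proper log-concave function on ℝ^d, s > 0, and let ‖f‖ denote the supremum of f. If 0 < α < ‖f‖^{1/s}, then among all d-symmetric ellipsoids of height α contained in lift_s(f), there is exactly one of maximal s-volume. Moreover, if there exists a d-symmetric ellipsoid of height ‖f‖^{1/s} contained in lift_s(f), then among all d-symmetric ellipsoids of height ‖f‖^{1/s} contained in lift_s(f), there is exactly one of maximal s-volume. -/

import Mathlib

open MeasureTheory
open scoped BigOperators RealInnerProductSpace

noncomputable section

/-- `ℝ^d` with the Euclidean structure. -/
abbrev Ed (d : ℕ) := EuclideanSpace ℝ (Fin d)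

/-- `f : ℝ^d → [0,∞)` is log-concave, i.e. `f = e^{-ψ}` for some convex
`ψ : ℝ^d → ℝ ∪ {∞}`; equivalently, `f ≥ 0` and
`f(tx+(1-t)y) ≥ f(x)^t f(y)^{1-t}`. -/
def IsLogConcave {d : ℕ} (f : Ed d → ℝ) : Prop :=
  (∀ x, 0 ≤ f x) ∧
    ∀ x y : Ed d, ∀ t : ℝ, 0 ≤ t → t ≤ 1 →
      f x ^ t * f y ^ (1 - t) ≤ f (t • x + (1 - t) • y)

/-- A proper log-concave function: log-concave, upper semicontinuous,
with positive finite integral. -/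
def ProperLogConcave {d : ℕ} (f : Ed d → ℝ) : Prop :=
  IsLogConcave f ∧ UpperSemicontinuous f ∧
    0 < ∫⁻ x, ENNReal.ofReal (f x) ∧ (∫⁻ x, ENNReal.ofReal (f x)) < ⊤

/-- The `s`-lifting of `f`, a subset of `ℝ^d × ℝ = ℝ^{d+1}`. -/
def sLift {d : ℕ} (s : ℝ) (f : Ed d → ℝ) : Set (Ed d × ℝ) :=
  {p | |p.2| ≤ f p.1 ^ (1 / s)}

/-- The `d`-symmetric ellipsoid `(A⊕α)B^{d+1} + a` in `ℝ^{d+1} = ℝ^d × ℝ`. -/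
def ellE {d : ℕ} (A : Matrix (Fin d) (Fin d) ℝ) (α : ℝ) (a : Ed d) : Set (Ed d × ℝ) :=
  {p | ∃ y : Ed d, ∃ t : ℝ, ‖y‖ ^ 2 + t ^ 2 ≤ 1 ∧
        p.1 = Matrix.toEuclideanLin A y + a ∧ p.2 = α * t}

/-- The closed Euclidean unit ball `B^{d+1}` of `ℝ^{d+1} = ℝ^d × ℝ`. -/
def unitBallE (d : ℕ) : Set (Ed d × ℝ) := {p | ‖p.1‖ ^ 2 + p.2 ^ 2 ≤ 1}

/-- `κ_s = ∫_{B^d} (1-|x|²)^{s/2} dx`. -/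
def kappa (d : ℕ) (s : ℝ) : ℝ :=
  ∫ x in Metric.closedBall (0 : Ed d) 1, (1 - ‖x‖ ^ 2) ^ (s / 2)

/-- The `s`-volume of the ellipsoid represented by `(A⊕α, a)`:
`μ_s = κ_s α^s det A`. -/
def svol {d : ℕ} (s : ℝ) (A : Matrix (Fin d) (Fin d) ℝ) (α : ℝ) : ℝ :=
  kappa d s * α ^ s * A.det

/-- `(A, α, a)` represents the John `s`-ellipsoid of `f`: it is a d-symmetric
ellipsoid contained in the `s`-lifting of `f` of maximal `s`-volume. -/
def IsJohn {d : ℕ} (s : ℝ) (f : Ed d → ℝ)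
    (A : Matrix (Fin d) (Fin d) ℝ) (α : ℝ) (a : Ed d) : Prop :=
  A.PosDef ∧ 0 < α ∧ ellE A α a ⊆ sLift s f ∧
    ∀ (A' : Matrix (Fin d) (Fin d) ℝ) (α' : ℝ) (a' : Ed d),
      A'.PosDef → 0 < α' → ellE A' α' a' ⊆ sLift s f → svol s A' α' ≤ svol s A α

/-- The height function of the ellipsoid represented by `(A⊕α, a)`. -/
def heightFn {d : ℕ} (A : Matrix (Fin d) (Fin d) ℝ) (α : ℝ) (a : Ed d) (x : Ed d) : ℝ :=
  if ‖Matrix.toEuclideanLin A⁻¹ (x - a)‖ ≤ 1 then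
    α * Real.sqrt (1 - ‖Matrix.toEuclideanLin A⁻¹ (x - a)‖ ^ 2)
  else 0

/-- A point of `ℝ^d × ℝ` as a vector in `ℝ^{d+1}`. -/
def augVec {d : ℕ} (p : Ed d × ℝ) : Fin (d + 1) → ℝ :=
  Fin.snoc (fun i => p.1 i) p.2

/-- The block-diagonal matrix `A ⊕ α`. -/
def matAug {d : ℕ} (A : Matrix (Fin d) (Fin d) ℝ) (α : ℝ) :
    Matrix (Fin (d + 1)) (Fin (d + 1)) ℝ :=
  Matrix.of fun i j =>
    Fin.lastCases (Fin.lastCases α (fun _ => 0) j)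
      (fun i' => Fin.lastCases 0 (fun j' => A i' j') j) i

/-- The Frobenius norm of a real matrix. -/
def frobNorm {n : ℕ} (M : Matrix (Fin n) (Fin n) ℝ) : ℝ :=
  Real.sqrt (∑ i, ∑ j, M i j ^ 2)

/-- Asplund sum (sup-convolution) of two functions. -/
def asplund {d : ℕ} (f g : Ed d → ℝ) : Ed d → ℝ :=
  fun x => ⨆ y : Ed d, f y * g (x - y)

/-- Epi-product `(λ ∗ f)(x) = f(x/λ)^λ`. -/
def epiProd {d : ℕ} (l : ℝ) (f : Ed d → ℝ) : Ed d → ℝ :=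
  fun x => f (l⁻¹ • x) ^ l

/-- The flat ellipsoid function `α · χ_{A B^d + a}`. -/
def flatFn {d : ℕ} (A : Matrix (Fin d) (Fin d) ℝ) (α : ℝ) (a : Ed d) (x : Ed d) : ℝ :=
  if ‖Matrix.toEuclideanLin A⁻¹ (x - a)‖ ≤ 1 then α else 0

/-- The Gaussian density `G[(A⊕α, a)](x) = α e^{−|A^{-1}(x−a)|²}`. -/
def gaussFn {d : ℕ} (A : Matrix (Fin d) (Fin d) ℝ) (α : ℝ) (a : Ed d) (x : Ed d) : ℝ :=
  α * Real.exp (-‖Matrix.toEuclideanLin A⁻¹ (x - a)‖ ^ 2)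

/-- Operator (`ℓ₂ → ℓ₂`) norm of a matrix. -/
def opNorm {d : ℕ} (M : Matrix (Fin d) (Fin d) ℝ) : ℝ :=
  ‖Matrix.toEuclideanCLM (𝕜 := ℝ) M‖

theorem IsLogConcave.convex_superlevel {d : ℕ} {f : Ed d → ℝ} (hf : IsLogConcave f) {c : ℝ}
    (hc : 0 ≤ c) : Convex ℝ {x | c ≤ f x} := by
  rcases hc.eq_or_lt with rfl | hc
  · rw [Set.eq_univ_of_forall (s := {x | 0 ≤ f x}) hf.1]
    exact convex_univ
  intro x hx y hy t u ht hu htu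
  obtain rfl : u = 1 - t := by linarith
  calc c = c ^ t * c ^ (1 - t) := by rw [← Real.rpow_add hc]; simp
    _ ≤ f x ^ t * f y ^ (1 - t) := by
      gcongr
      exacts [Real.rpow_nonneg (hf.1 x) _, hx, hy]
    _ ≤ f (t • x + (1 - t) • y) := hf.2 x y t ht (by linarith)

theorem ProperLogConcave.exists_closedBall_le {d : ℕ} {f : Ed d → ℝ} (hf : ProperLogConcave f) :
    ∃ x₀ : Ed d, ∃ r > 0, ∃ ε > 0, ∀ x ∈ Metric.closedBall x₀ r, ε ≤ f x := by
  obtain ⟨hlc, husc, hpos, -⟩ := hf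
  have hcover : volume (⋃ n : ℕ, {x | (1 / ((n : ℝ) + 1)) ≤ f x}) ≠ 0 := by
    intro h
    refine hpos.ne' (lintegral_eq_zero_of_ae_eq_zero ?_)
    refine measure_mono_null (fun x hx => ?_) h
    have hx' : 0 < f x := by simpa using hx
    obtain ⟨n, hn⟩ := exists_nat_one_div_lt hx'
    exact Set.mem_iUnion.2 ⟨n, hn.le⟩
  obtain ⟨n, hn⟩ := exists_measure_pos_of_not_measure_iUnion_null hcover
  have hε : (0 : ℝ) < 1 / ((n : ℝ) + 1) := by positivity
  have hconv := hlc.convex_superlevel hε.le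
  have hint : (interior {x | (1 / ((n : ℝ) + 1)) ≤ f x}).Nonempty := by
    rw [hconv.interior_nonempty_iff_affineSpan_eq_top]
    by_contra hne
    exact hn.ne' (measure_mono_null (subset_affineSpan ℝ _)
      (Measure.addHaar_affineSubspace _ _ hne))
  obtain ⟨x₀, hx₀⟩ := hint
  obtain ⟨r, hr, hball⟩ := Metric.nhds_basis_closedBall.mem_iff.1 (mem_interior_iff_mem_nhds.1 hx₀)
  exact ⟨x₀, r, hr, _, hε, fun x hx => hball hx⟩

theorem IsLogConcave.closedBall_midpoint_le {d : ℕ} {f : Ed d → ℝ} (hf : IsLogConcave f)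
    {x₀ y : Ed d} {r ε c : ℝ} (hε : 0 ≤ ε) (hc : 0 ≤ c)
    (hball : ∀ x ∈ Metric.closedBall x₀ r, ε ≤ f x) (hy : c ≤ f y) :
    Metric.closedBall ((1 / 2 : ℝ) • (x₀ + y)) (r / 2) ⊆
      {x | ε ^ (1 / 2 : ℝ) * c ^ (1 / 2 : ℝ) ≤ f x} := by
  intro z hz
  have hw : (2 : ℝ) • z - y ∈ Metric.closedBall x₀ r := by
    rw [mem_closedBall_iff_norm] at hz ⊢
    have h : (2 : ℝ) • z - y - x₀ = (2 : ℝ) • (z - (1 / 2 : ℝ) • (x₀ + y)) := by module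
    rw [h, norm_smul, Real.norm_two]
    linarith
  have h := hf.2 ((2 : ℝ) • z - y) y (1 / 2) (by norm_num) (by norm_num)
  have hz' : (1 / 2 : ℝ) • ((2 : ℝ) • z - y) + (1 - 1 / 2 : ℝ) • y = z := by module
  rw [hz', show (1 - 1 / 2 : ℝ) = 1 / 2 by norm_num] at h
  refine le_trans ?_ h
  gcongr
  · exact Real.rpow_nonneg (hf.1 _) _
  · exact hball _ hw

theorem ProperLogConcave.measurable {d : ℕ} {f : Ed d → ℝ} (hf : ProperLogConcave f) :
    Measurable f :=
  hf.2.1.measurable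

/-- Markov's inequality for the superlevel sets of a proper log-concave function. -/
theorem ProperLogConcave.mul_volume_superlevel_le {d : ℕ} {f : Ed d → ℝ}
    (hf : ProperLogConcave f) (c : ℝ) :
    ENNReal.ofReal c * volume {x | c ≤ f x} ≤ ∫⁻ x, ENNReal.ofReal (f x) := by
  refine le_trans ?_ (mul_meas_ge_le_lintegral hf.measurable.ennreal_ofReal (ENNReal.ofReal c))
  gcongr with x
  exact ENNReal.ofReal_le_ofReal

theorem ProperLogConcave.bddAbove_range {d : ℕ} {f : Ed d → ℝ} (hf : ProperLogConcave f) :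
    BddAbove (Set.range f) := by
  obtain ⟨x₀, r, hr, ε, hε, hball⟩ := hf.exists_closedBall_le
  set V := volume (Metric.closedBall (0 : Ed d) (r / 2)) with hV
  have hV0 : V ≠ 0 := (Metric.measure_closedBall_pos volume _ (by positivity)).ne'
  have hVtop : V ≠ ⊤ := measure_closedBall_lt_top.ne
  set J := ((∫⁻ x, ENNReal.ofReal (f x)) / V).toReal with hJ
  refine ⟨(J / ε ^ (1 / 2 : ℝ)) ^ 2, ?_⟩
  rintro _ ⟨y, rfl⟩
  rcases (hf.1.1 y).eq_or_lt with hy | hy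
  · rw [← hy]; positivity
  have h1 := hf.mul_volume_superlevel_le (ε ^ (1 / 2 : ℝ) * f y ^ (1 / 2 : ℝ))
  have h2 := measure_mono (μ := volume)
    (hf.1.closedBall_midpoint_le (y := y) hε.le hy.le hball le_rfl)
  rw [Measure.addHaar_closedBall_center, ← hV] at h2
  have h3 : ENNReal.ofReal (ε ^ (1 / 2 : ℝ) * f y ^ (1 / 2 : ℝ)) ≤
      (∫⁻ x, ENNReal.ofReal (f x)) / V := by
    rw [ENNReal.le_div_iff_mul_le (Or.inl hV0) (Or.inl hVtop)]
    exact le_trans (by gcongr) h1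
  have h4 : ε ^ (1 / 2 : ℝ) * f y ^ (1 / 2 : ℝ) ≤ J :=
    (ENNReal.ofReal_le_iff_le_toReal (ENNReal.div_ne_top hf.2.2.2.ne hV0)).1 h3
  have h5 : f y ^ (1 / 2 : ℝ) ≤ J / ε ^ (1 / 2 : ℝ) := by
    rw [le_div_iff₀ (by positivity)]; linarith
  calc f y = (f y ^ (1 / 2 : ℝ)) ^ 2 := by
        rw [← Real.sqrt_eq_rpow, Real.sq_sqrt hy.le]
    _ ≤ _ := by gcongr

theorem ProperLogConcave.isBounded_superlevel {d : ℕ} {f : Ed d → ℝ} (hf : ProperLogConcave f)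
    {c : ℝ} (hc : 0 < c) : ∃ R, ∀ x, c ≤ f x → ‖x‖ ≤ R := by
  obtain ⟨x₀, r, hr, ε, hε, hball⟩ := hf.exists_closedBall_le
  set c' := ε ^ (1 / 2 : ℝ) * c ^ (1 / 2 : ℝ) with hc'
  have hc'0 : 0 < c' := by positivity
  set K := {x | c' ≤ f x} with hK
  have hKm : MeasurableSet K := measurableSet_le measurable_const hf.measurable
  have hKfin : volume K ≠ ⊤ := by
    intro h
    have := hf.mul_volume_superlevel_le c'
    rw [← hK, h, ENNReal.mul_top (by simpa using hc'0)] at this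
    exact (this.trans_lt hf.2.2.2).ne rfl
  set V := volume (Metric.closedBall (0 : Ed d) (r / 2)) with hV
  have hV0 : 0 < V := Metric.measure_closedBall_pos volume _ (by positivity)
  have htend := tendsto_measure_iInter_atTop (μ := volume)
    (s := fun n : ℕ => K \ Metric.closedBall (0 : Ed d) n)
    (fun n => (hKm.diff Metric.isClosed_closedBall.measurableSet).nullMeasurableSet)
    (fun m n hmn => Set.sdiff_subset_sdiff_right
      (Metric.closedBall_subset_closedBall (by exact_mod_cast hmn)))
    ⟨0, measure_ne_top_of_subset Set.sdiff_subset hKfin⟩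
  have hempty : ⋂ n : ℕ, K \ Metric.closedBall (0 : Ed d) n = ∅ := by
    refine Set.eq_empty_of_forall_notMem fun x hx => ?_
    obtain ⟨n, hn⟩ := exists_nat_ge ‖x‖
    exact (Set.mem_iInter.1 hx n).2 (by simpa using hn)
  rw [hempty, measure_empty] at htend
  obtain ⟨n, hn⟩ := (htend.eventually (gt_mem_nhds hV0)).exists
  refine ⟨2 * (n + r / 2) + ‖x₀‖, fun y hy => ?_⟩
  have hsub := hf.1.closedBall_midpoint_le hε.le hc.le hball hy
  by_contra! hlt
  refine hn.not_ge ?_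
  rw [hV, ← Measure.addHaar_closedBall_center volume ((1 / 2 : ℝ) • (x₀ + y))]
  refine measure_mono fun z hz => ⟨hsub hz, fun hzn => ?_⟩
  rw [mem_closedBall_iff_norm] at hz hzn
  rw [sub_zero] at hzn
  have h : y = (2 : ℝ) • (z - (z - (1 / 2 : ℝ) • (x₀ + y))) - x₀ := by module
  have h' : ‖y‖ ≤ 2 * (‖z‖ + ‖z - (1 / 2 : ℝ) • (x₀ + y)‖) + ‖x₀‖ := by
    conv_lhs => rw [h]
    refine (norm_sub_le _ _).trans ?_
    rw [norm_smul, Real.norm_two]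
    gcongr
    exact norm_sub_le _ _
  linarith

theorem kappa_pos (d : ℕ) {s : ℝ} (hs : 0 < s) : 0 < kappa d s := by
  have hcont : Continuous fun x : Ed d => (1 - ‖x‖ ^ 2) ^ (s / 2) :=
    (continuous_const.sub (continuous_norm.pow 2)).rpow_const fun _ => Or.inr (by positivity)
  have hint : IntegrableOn (fun x : Ed d => (1 - ‖x‖ ^ 2) ^ (s / 2))
      (Metric.closedBall (0 : Ed d) 1) :=
    hcont.continuousOn.integrableOn_compact (isCompact_closedBall _ _)
  refine (setIntegral_pos_iff_support_of_nonneg_ae ?_ hint).2 ?_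
  · refine (ae_restrict_iff' Metric.isClosed_closedBall.measurableSet).2 (ae_of_all _ ?_)
    intro x hx
    have : ‖x‖ ≤ 1 := by simpa using hx
    exact Real.rpow_nonneg (by nlinarith [norm_nonneg x]) _
  · refine (Metric.measure_ball_pos volume (0 : Ed d) one_pos).trans_le (measure_mono ?_)
    intro x hx
    have : ‖x‖ < 1 := by simpa using hx
    refine ⟨(Real.rpow_pos_of_pos (by nlinarith [norm_nonneg x]) _).ne', ?_⟩
    simpa using this.le

theorem svol_le_svol_iff {d : ℕ} {s α : ℝ} (hs : 0 < s) (hα : 0 < α)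
    {A B : Matrix (Fin d) (Fin d) ℝ} : svol s A α ≤ svol s B α ↔ A.det ≤ B.det :=
  mul_le_mul_iff_right₀ (mul_pos (kappa_pos d hs) (Real.rpow_pos_of_pos hα s))

theorem Matrix.PosDef.eq_one_of_det_le {n : Type*} [Fintype n] [DecidableEq n]
    {C : Matrix n n ℝ} (hC : C.PosDef) (hdet : C.det = 1)
    (hmid : ((1 / 2 : ℝ) • (1 + C)).det ≤ 1) : C = 1 := by
  set l := hC.1.eigenvalues with hl
  have hpos : ∀ i, 0 < l i := hC.eigenvalues_pos
  have hspec : C = (hC.1.eigenvectorUnitary : Matrix n n ℝ) * Matrix.diagonal l *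
      star (hC.1.eigenvectorUnitary : Matrix n n ℝ) := by
    conv_lhs => rw [hC.1.spectral_theorem, Unitary.conjStarAlgAut_apply]
    rfl
  set U := (hC.1.eigenvectorUnitary : Matrix n n ℝ) with hU
  have hUU : U * star U = 1 := Unitary.coe_mul_star_self _
  have hmid_eq : (1 / 2 : ℝ) • (1 + C) =
      U * Matrix.diagonal (fun i => (1 + l i) / 2) * star U := by
    have h : (Matrix.diagonal fun i => (1 + l i) / 2) =
        (1 / 2 : ℝ) • (1 + Matrix.diagonal l) := by
      ext i j
      by_cases hij : i = j
      · subst hij; simp; ring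
      · simp [hij]
    rw [h, Matrix.mul_smul, Matrix.smul_mul, Matrix.mul_add, Matrix.add_mul, Matrix.mul_one, hUU,
      ← hspec]
  have hdetU : U.det * (star U).det = 1 := by rw [← Matrix.det_mul, hUU, Matrix.det_one]
  have hdet_conj : ∀ v : n → ℝ, (U * Matrix.diagonal v * star U).det = ∏ i, v i := by
    intro v
    rw [Matrix.det_mul, Matrix.det_mul, Matrix.det_diagonal]
    linear_combination (∏ i, v i) * hdetU
  rw [hmid_eq, hdet_conj] at hmid
  have hprod : ∏ i, l i = 1 := by rw [← hdet_conj l, ← hspec, hdet]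
  have hone : ∀ i, l i = 1 := by
    by_contra! hne
    obtain ⟨i, hi⟩ := hne
    have hlt : ∏ i, l i < ∏ i, ((1 + l i) / 2) ^ 2 := by
      refine Finset.prod_lt_prod (fun j _ => hpos j) (fun j _ => ?_) ⟨i, Finset.mem_univ i, ?_⟩
      · nlinarith [sq_nonneg (1 - l j)]
      · nlinarith [sq_pos_of_ne_zero (sub_ne_zero.2 hi)]
    rw [hprod, Finset.prod_pow] at hlt
    have h0 : 0 ≤ ∏ i, (1 + l i) / 2 :=
      Finset.prod_nonneg fun j _ => by have := hpos j; positivity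
    nlinarith
  have hl1 : l = fun _ => 1 := funext hone
  rw [hspec, hl1, Matrix.diagonal_one, Matrix.mul_one, hUU]

theorem Matrix.PosDef.eq_of_det_midpoint_le {n : Type*} [Fintype n] [DecidableEq n]
    {A B : Matrix n n ℝ} (hA : A.PosDef) (hB : B.PosDef) (hAB : A.det = B.det)
    (hmid : ((1 / 2 : ℝ) • (A + B)).det ≤ A.det) : A = B := by
  obtain ⟨L, hL⟩ : ∃ L : Matrix n n ℝ, A = star L * L := by
    open scoped MatrixOrder in
    exact CStarAlgebra.nonneg_iff_eq_star_mul_self.mp hA.posSemidef.nonneg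
  have hdetA : A.det = (star L).det * L.det := by rw [hL, Matrix.det_mul]
  have hA0 := hA.det_pos
  have hLu : IsUnit L.det := by
    rw [isUnit_iff_ne_zero]
    rintro h
    rw [hdetA, h, mul_zero] at hA0
    exact lt_irrefl _ hA0
  have hL1 : L * L⁻¹ = 1 := Matrix.mul_nonsing_inv _ hLu
  have hL2 : star L⁻¹ * star L = 1 := by rw [← star_mul, hL1, star_one]
  have hL3 : star L * star L⁻¹ = 1 := by rw [← star_mul, Matrix.nonsing_inv_mul _ hLu, star_one]
  have hAC : star L⁻¹ * A * L⁻¹ = 1 := by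
    rw [hL, ← mul_assoc, hL2, one_mul, hL1]
  have hCA : ∀ M : Matrix n n ℝ, star L * (star L⁻¹ * M * L⁻¹) * L = M := by
    intro M
    calc star L * (star L⁻¹ * M * L⁻¹) * L = (star L * star L⁻¹) * M * (L⁻¹ * L) := by
          simp only [mul_assoc]
      _ = M := by rw [hL3, Matrix.nonsing_inv_mul _ hLu, one_mul, mul_one]
  have hdet : ∀ M : Matrix n n ℝ, A.det * (star L⁻¹ * M * L⁻¹).det = M.det := by
    intro M
    conv_rhs => rw [← hCA M, Matrix.det_mul, Matrix.det_mul]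
    rw [hdetA]; ring
  have hCpos : (star L⁻¹ * B * L⁻¹).PosDef := by
    have hu : IsUnit L⁻¹ := by
      rw [Matrix.isUnit_iff_isUnit_det]; exact Matrix.isUnit_nonsing_inv_det _ hLu
    exact (Matrix.IsUnit.posDef_star_left_conjugate_iff hu).2 hB
  have hC : star L⁻¹ * B * L⁻¹ = 1 := by
    refine hCpos.eq_one_of_det_le ?_ ?_
    · have := hdet B
      rw [← hAB] at this
      exact mul_left_cancel₀ hA0.ne' (by rw [this, mul_one])
    · have h : (1 / 2 : ℝ) • (1 + star L⁻¹ * B * L⁻¹) =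
          star L⁻¹ * ((1 / 2 : ℝ) • (A + B)) * L⁻¹ := by
        rw [Matrix.mul_smul, Matrix.smul_mul, Matrix.mul_add, Matrix.add_mul, hAC]
      rw [h]
      refine le_of_mul_le_mul_left ?_ hA0
      rwa [hdet, mul_one]
  rw [← hCA A, hAC, ← hCA B, hC]

theorem Matrix.PosDef.det_lt_det_add_smul_vecMulVec {n : Type*} [Fintype n] [DecidableEq n]
    {A : Matrix n n ℝ} (hA : A.PosDef) {w : n → ℝ} (hw : w ≠ 0) {δ : ℝ} (hδ : 0 < δ) :
    A.det < (A + δ • Matrix.vecMulVec w w).det := by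
  have hpos : 0 < w ⬝ᵥ A⁻¹.mulVec w := by
    simpa using hA.inv.dotProduct_mulVec_pos hw
  have h : δ • Matrix.vecMulVec w w =
      Matrix.replicateCol Unit (δ • w) * Matrix.replicateRow Unit w := by
    rw [← Matrix.vecMulVec_eq, Matrix.smul_vecMulVec]
  rw [h, Matrix.det_add_replicateCol_mul_replicateRow hA.det_pos.ne'.isUnit]
  have h2 : (1 + Matrix.replicateRow Unit w * A⁻¹ * Matrix.replicateCol Unit (δ • w)).det =
      1 + δ * (w ⬝ᵥ A⁻¹.mulVec w) := by
    rw [Matrix.det_unique, Matrix.mul_assoc]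
    simp [Matrix.mul_apply, dotProduct, Matrix.mulVec, Finset.mul_sum]
  rw [h2]
  nlinarith [mul_pos hA.det_pos (mul_pos hδ hpos)]

/-- Fibrewise form of the inclusion of the `d`-symmetric ellipsoid `(A ⊕ α) B^{d+1} + a` in the
`s`-lifting of `f`. -/
def EllipsoidBelow {d : ℕ} (s : ℝ) (f : Ed d → ℝ) (α : ℝ) (A : Matrix (Fin d) (Fin d) ℝ)
    (a : Ed d) : Prop :=
  ∀ (y : Ed d) (t : ℝ), ‖y‖ ^ 2 + t ^ 2 ≤ 1 →
    (α * |t|) ^ s ≤ f (Matrix.toEuclideanLin A y + a)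

theorem ellE_subset_sLift_iff {d : ℕ} {s α : ℝ} (hs : 0 < s) (hα : 0 < α) {f : Ed d → ℝ}
    (hf : ∀ x, 0 ≤ f x) {A : Matrix (Fin d) (Fin d) ℝ} {a : Ed d} :
    ellE A α a ⊆ sLift s f ↔ EllipsoidBelow s f α A a := by
  have key : ∀ (x : Ed d) (t : ℝ), (x, α * t) ∈ sLift s f ↔ (α * |t|) ^ s ≤ f x := by
    intro x t
    simp only [sLift, Set.mem_ofPred_eq, abs_mul, abs_of_pos hα, one_div]
    exact Real.le_rpow_inv_iff_of_pos (by positivity) (hf x) hs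
  constructor
  · intro h y t hyt
    exact (key _ _).1 (h ⟨y, t, hyt, rfl, rfl⟩)
  · rintro h ⟨x, u⟩ ⟨y, t, hyt, hx, hu⟩
    dsimp only at hx hu
    subst hx hu
    exact (key _ _).2 (h y t hyt)

theorem ProperLogConcave.exists_ellipsoidBelow {d : ℕ} {s α : ℝ} (hs : 0 < s) (hα : 0 < α)
    {f : Ed d → ℝ} (hf : ProperLogConcave f) {y : Ed d} (hy : α ^ s < f y) :
    ∃ (A : Matrix (Fin d) (Fin d) ℝ) (a : Ed d), A.PosDef ∧ EllipsoidBelow s f α A a := by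
  obtain ⟨x₀, r, hr, ε, hε, hball⟩ := hf.exists_closedBall_le
  have hfy : 0 < f y := lt_of_le_of_lt (by positivity) hy
  have hcont : Continuous fun t : ℝ => ε ^ t * f y ^ (1 - t) :=
    (Real.continuous_const_rpow hε.ne').mul
      ((Real.continuous_const_rpow hfy.ne').comp (continuous_const.sub continuous_id))
  have hev : ∀ᶠ t in nhds (0 : ℝ), α ^ s < ε ^ t * f y ^ (1 - t) :=
    (hcont.tendsto 0).eventually (lt_mem_nhds (by simpa using hy))
  obtain ⟨t, ht, ht0, ht1⟩ := ((hev.filter_mono nhdsWithin_le_nhds).and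
    (Ioo_mem_nhdsGT (zero_lt_one' ℝ))).exists
  refine ⟨(t * r) • 1, t • x₀ + (1 - t) • y, Matrix.PosDef.one.smul (mul_pos ht0 hr), ?_⟩
  intro v τ hv
  have hv1 : ‖v‖ ≤ 1 := by nlinarith [sq_nonneg τ, norm_nonneg v]
  have hτ : |τ| ≤ 1 := by rw [abs_le]; constructor <;> nlinarith [sq_nonneg ‖v‖]
  have hz : Matrix.toEuclideanLin ((t * r) • (1 : Matrix (Fin d) (Fin d) ℝ)) v +
      (t • x₀ + (1 - t) • y) = t • (x₀ + r • v) + (1 - t) • y := by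
    rw [map_smul, LinearMap.smul_apply, Matrix.toLpLin_one, LinearMap.id_apply]
    module
  have hw : x₀ + r • v ∈ Metric.closedBall x₀ r := by
    rw [mem_closedBall_iff_norm, add_sub_cancel_left, norm_smul, Real.norm_of_nonneg hr.le]
    nlinarith
  rw [hz]
  calc (α * |τ|) ^ s ≤ α ^ s := by
        gcongr
        nlinarith
    _ ≤ ε ^ t * f y ^ (1 - t) := ht.le
    _ ≤ f (x₀ + r • v) ^ t * f y ^ (1 - t) := by
        gcongr
        exact hball _ hw
    _ ≤ _ := hf.1.2 _ _ _ ht0.le ht1.le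

theorem isClosed_setOf_posSemidef {n : Type*} [Fintype n] :
    IsClosed {A : Matrix n n ℝ | A.PosSemidef} := by
  simp only [Matrix.posSemidef_iff_dotProduct_mulVec, Set.ofPred_and, Set.ofPred_forall]
  refine IsClosed.inter ?_ (isClosed_iInter fun x => ?_)
  · exact isClosed_eq continuous_id.matrix_conjTranspose continuous_id
  · exact isClosed_le continuous_const
      (continuous_const.dotProduct (continuous_id.matrix_mulVec continuous_const))

theorem ProperLogConcave.isCompact_setOf_ellipsoidBelow {d : ℕ} {s α : ℝ}
    (hα : 0 < α) {f : Ed d → ℝ} (hf : ProperLogConcave f) :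
    IsCompact {p : Matrix (Fin d) (Fin d) ℝ × Ed d |
      p.1.PosSemidef ∧ EllipsoidBelow s f α p.1 p.2} := by
  obtain ⟨R, hR⟩ := hf.isBounded_superlevel (c := (α * |1 / 2|) ^ s) (by positivity)
  have hcpt : IsCompact ((Set.univ.pi fun _ : Fin d => Set.univ.pi fun _ : Fin d =>
      Set.Icc (-(4 * R)) (4 * R)) ×ˢ Metric.closedBall (0 : Ed d) R) :=
    (isCompact_univ_pi fun _ => isCompact_univ_pi fun _ => isCompact_Icc).prod
      (isCompact_closedBall _ _)
  refine hcpt.of_isClosed_subset ?_ ?_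
  · rw [Set.ofPred_and]
    refine (isClosed_setOf_posSemidef.preimage continuous_fst).inter ?_
    simp only [EllipsoidBelow, Set.ofPred_forall]
    refine isClosed_iInter fun y => isClosed_iInter fun t => isClosed_iInter fun _ => ?_
    refine (hf.2.1.isClosed_preimage ((α * |t|) ^ s)).preimage ?_
    simp only [Matrix.toLpLin_apply]
    exact ((PiLp.continuous_toLp 2 _).comp
      (continuous_fst.matrix_mulVec continuous_const)).add continuous_snd
  · rintro ⟨(A : Matrix (Fin d) (Fin d) ℝ), a⟩ ⟨-, hA⟩
    dsimp only at hA
    have ha : ‖a‖ ≤ R := by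
      simpa using hR _ (hA 0 (1 / 2) (by norm_num))
    refine ⟨fun i _ j _ => ?_, by simpa using ha⟩
    have hj := hR _ (hA ((1 / 2 : ℝ) • EuclideanSpace.single j 1) (1 / 2)
      (by rw [norm_smul]; norm_num))
    set v := Matrix.toEuclideanLin A (EuclideanSpace.single j 1) with hv
    rw [map_smul, ← hv] at hj
    have hnorm : ‖v‖ ≤ 4 * R := by
      have h : v = (2 : ℝ) • ((1 / 2 : ℝ) • v + a - a) := by module
      rw [h, norm_smul, Real.norm_two]
      have := norm_sub_le ((1 / 2 : ℝ) • v + a) a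
      linarith
    have hij : v i = A i j := by
      simp [hv]
    change A i j ∈ _
    rw [Set.mem_Icc, ← abs_le, ← hij]
    exact (PiLp.norm_apply_le v i).trans hnorm

theorem EllipsoidBelow.midpoint {d : ℕ} {s α : ℝ} (hα : 0 < α) {f : Ed d → ℝ}
    (hf : IsLogConcave f) {A B : Matrix (Fin d) (Fin d) ℝ} {a b : Ed d}
    (hA : EllipsoidBelow s f α A a) (hB : EllipsoidBelow s f α B b) :
    EllipsoidBelow s f α ((1 / 2 : ℝ) • (A + B)) ((1 / 2 : ℝ) • (a + b)) := by
  intro y t hyt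
  have h := hf.convex_superlevel (c := (α * |t|) ^ s) (by positivity) (hA y t hyt) (hB y t hyt)
    (a := 1 / 2) (b := 1 / 2) (by norm_num) (by norm_num) (by norm_num)
  refine h.trans_eq (congrArg f ?_)
  rw [map_smul, map_add, LinearMap.smul_apply, LinearMap.add_apply]
  module

theorem toEuclideanLin_add_smul_vecMulVec {d : ℕ} (A : Matrix (Fin d) (Fin d) ℝ) (δ : ℝ)
    (w y : Ed d) :
    Matrix.toEuclideanLin (A + δ • Matrix.vecMulVec w.ofLp w.ofLp) y =
      Matrix.toEuclideanLin A y + (δ * ⟪w, y⟫) • w := by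
  ext i
  simp [Matrix.toLpLin_apply, Matrix.vecMulVec_mulVec,
    EuclideanSpace.inner_eq_star_dotProduct, dotProduct_comm]
  ring

/-- Two translates of one ellipsoid lying below `f` can be replaced by a longer ellipsoid. -/
theorem EllipsoidBelow.elongate {d : ℕ} {s α : ℝ} (hα : 0 < α) {f : Ed d → ℝ}
    (hf : IsLogConcave f) {A : Matrix (Fin d) (Fin d) ℝ} {a w : Ed d} (hw : w ≠ 0)
    (hA₁ : EllipsoidBelow s f α A (a - w)) (hA₂ : EllipsoidBelow s f α A (a + w)) :
    EllipsoidBelow s f α (A + ‖w‖⁻¹ • Matrix.vecMulVec w.ofLp w.ofLp) a := by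
  intro y t hyt
  have hy : ‖y‖ ≤ 1 := by nlinarith [sq_nonneg t, norm_nonneg y]
  have hw0 : 0 < ‖w‖ := norm_pos_iff.2 hw
  rw [toEuclideanLin_add_smul_vecMulVec]
  set c := ‖w‖⁻¹ * ⟪w, y⟫ with hc
  have hc1 : |c| ≤ 1 := by
    rw [hc, abs_mul, abs_of_pos (inv_pos.2 hw0), inv_mul_le_iff₀ hw0]
    exact (abs_real_inner_le_norm w y).trans (by gcongr)
  obtain ⟨hc2, hc3⟩ := abs_le.1 hc1
  have h := hf.convex_superlevel (c := (α * |t|) ^ s) (by positivity)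
    (hA₁ y t hyt) (hA₂ y t hyt) (a := (1 - c) / 2) (b := (1 + c) / 2)
    (by linarith) (by linarith) (by ring)
  refine h.trans_eq (congrArg f ?_)
  module

theorem ProperLogConcave.existsUnique_max {d : ℕ} {s α : ℝ} (hs : 0 < s) (hα : 0 < α)
    {f : Ed d → ℝ} (hf : ProperLogConcave f)
    (hne : ∃ (A : Matrix (Fin d) (Fin d) ℝ) (a : Ed d),
      A.PosDef ∧ EllipsoidBelow s f α A a) :
    ∃! p : Matrix (Fin d) (Fin d) ℝ × Ed d,
      p.1.PosDef ∧ ellE p.1 α p.2 ⊆ sLift s f ∧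
        ∀ (A' : Matrix (Fin d) (Fin d) ℝ) (a' : Ed d),
          A'.PosDef → ellE A' α a' ⊆ sLift s f → svol s A' α ≤ svol s p.1 α := by
  simp only [ellE_subset_sLift_iff hs hα hf.1.1, svol_le_svol_iff hs hα]
  obtain ⟨A₀, a₀, hA₀, hE₀⟩ := hne
  refine existsUnique_of_exists_of_unique ?_ ?_
  · obtain ⟨⟨A, a⟩, ⟨hA, hE⟩, hmax⟩ :=
      (hf.isCompact_setOf_ellipsoidBelow hα).exists_isMaxOn ⟨(A₀, a₀), hA₀.posSemidef, hE₀⟩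
        (f := fun p => p.1.det) continuous_fst.matrix_det.continuousOn
    have hdet : A₀.det ≤ A.det := hmax (a := (A₀, a₀)) ⟨hA₀.posSemidef, hE₀⟩
    refine ⟨(A, a), hA.posDef_iff_det_ne_zero.2 (hA₀.det_pos.trans_le hdet).ne', hE, ?_⟩
    intro A' a' hA' hE'
    exact hmax (a := (A', a')) ⟨hA'.posSemidef, hE'⟩
  · rintro ⟨A, a⟩ ⟨B, b⟩ ⟨hA, hEA, hmaxA⟩ ⟨hB, hEB, hmaxB⟩
    dsimp only at *
    obtain rfl : A = B := by
      refine hA.eq_of_det_midpoint_le hB (le_antisymm (hmaxB _ _ hA hEA) (hmaxA _ _ hB hEB)) ?_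
      exact hmaxA _ _ ((hA.add hB).smul (by norm_num)) (hEA.midpoint hα hf.1 hEB)
    congr 1
    by_contra hab
    set w := (1 / 2 : ℝ) • (b - a) with hw
    have hw0 : w ≠ 0 := smul_ne_zero (by norm_num) (sub_ne_zero.2 (Ne.symm hab))
    have hδ : 0 < ‖w‖⁻¹ := inv_pos.2 (norm_pos_iff.2 hw0)
    have ha : (1 / 2 : ℝ) • (a + b) - w = a := by rw [hw]; module
    have hb : (1 / 2 : ℝ) • (a + b) + w = b := by rw [hw]; module
    have hE := EllipsoidBelow.elongate hα hf.1 hw0 (ha.symm ▸ hEA) (hb.symm ▸ hEB)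
    have hpos : (A + ‖w‖⁻¹ • Matrix.vecMulVec w.ofLp w.ofLp).PosDef :=
      hA.add_posSemidef ((Matrix.posSemidef_vecMulVec_self_star w.ofLp).smul hδ.le)
    refine (hA.det_lt_det_add_smul_vecMulVec ?_ hδ).not_ge (hmaxA _ _ hpos hE)
    exact fun h => hw0 (WithLp.ofLp_injective 2 h)

/-- **Uniqueness of the maximal-`s`-volume ellipsoid of fixed height**
(Lemma 4.4). -/
theorem unique_max_svolume_fixed_height (d : ℕ) (hd : 1 ≤ d) (s : ℝ) (hs : 0 < s)
    (f : Ed d → ℝ) (hf : ProperLogConcave f) :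
    (∀ α : ℝ, 0 < α → α < (⨆ x, f x) ^ (1 / s) →
      ∃! p : Matrix (Fin d) (Fin d) ℝ × Ed d,
        p.1.PosDef ∧ ellE p.1 α p.2 ⊆ sLift s f ∧
          ∀ (A' : Matrix (Fin d) (Fin d) ℝ) (a' : Ed d),
            A'.PosDef → ellE A' α a' ⊆ sLift s f →
              svol s A' α ≤ svol s p.1 α) ∧
    ((∃ (A : Matrix (Fin d) (Fin d) ℝ) (a : Ed d),
        A.PosDef ∧ ellE A ((⨆ x, f x) ^ (1 / s)) a ⊆ sLift s f) →
      ∃! p : Matrix (Fin d) (Fin d) ℝ × Ed d,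
        p.1.PosDef ∧ ellE p.1 ((⨆ x, f x) ^ (1 / s)) p.2 ⊆ sLift s f ∧
          ∀ (A' : Matrix (Fin d) (Fin d) ℝ) (a' : Ed d),
            A'.PosDef → ellE A' ((⨆ x, f x) ^ (1 / s)) a' ⊆ sLift s f →
              svol s A' ((⨆ x, f x) ^ (1 / s)) ≤
                svol s p.1 ((⨆ x, f x) ^ (1 / s))) := by
  refine ⟨fun α hα hlt => ?_, fun hex => ?_⟩
  · refine hf.existsUnique_max hs hα ?_
    have hsup : 0 ≤ ⨆ x, f x := Real.iSup_nonneg hf.1.1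
    rw [one_div, Real.lt_rpow_inv_iff_of_pos hα.le hsup hs] at hlt
    obtain ⟨y, hy⟩ := exists_lt_of_lt_ciSup hlt
    exact hf.exists_ellipsoidBelow hs hα hy
  · have hα : 0 < (⨆ x, f x) ^ (1 / s) := by
      obtain ⟨x₀, r, hr, ε, hε, hball⟩ := hf.exists_closedBall_le
      exact Real.rpow_pos_of_pos (hε.trans_le ((hball x₀ (Metric.mem_closedBall_self hr.le)).trans
        (le_ciSup hf.bddAbove_range x₀))) _
    refine hf.existsUnique_max hs hα ?_
    simpa only [ellE_subset_sLift_iff hs hα hf.1.1] using hex
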